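/- arXiv:2111.03198 — 2 statements merged into one kernel-verified Lean document; each statement's English description precedes it below -/
import Mathlib

section
/- For every j ∈ [L], one has Σ_{i=j}^{L} (2 − a_i/A_{≥i}) = A_{≥j}/a_j. -/
/-- Backward recursion `δ` indexed by distance from `L`: `deltaAux 0 = δ_L = 1`. -/
noncomputable def deltaAux : ℕ → ℝ
  | 0 => 1
  | t + 1 => 1 + ((1 + Real.sqrt (1 + 4 / deltaAux t)) / 2) * deltaAux t

/-- `δ_ℓ` for `1 ≤ ℓ ≤ L`. -/
noncomputable def deltaSeq (L ℓ : ℕ) : ℝ := deltaAux (L - ℓ)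

/-- `a_ℓ = ∏_{i=1}^{ℓ-1} 1/(1 − 1/δ_i)`. -/
noncomputable def aSeq (L ℓ : ℕ) : ℝ := ∏ i ∈ Finset.Ico 1 ℓ, 1 / (1 - 1 / deltaSeq L i)

/-- `A_{≥j} = Σ_{i=j}^{L} a_i`. -/
noncomputable def Ageq (L j : ℕ) : ℝ := ∑ i ∈ Finset.Icc j L, aSeq L i

theorem deltaAux_pos (t : ℕ) : 0 < deltaAux t := by
  induction t with
  | zero => simp [deltaAux]
  | succ t ih => rw [deltaAux]; positivity

theorem one_lt_deltaAux_succ (t : ℕ) : 1 < deltaAux (t + 1) := by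
  have := deltaAux_pos t
  rw [deltaAux]
  exact lt_add_of_pos_right 1 (by positivity)

theorem sq_deltaAux_succ_sub_one (t : ℕ) :
    (deltaAux (t + 1) - 1) ^ 2 = deltaAux (t + 1) * deltaAux t := by
  have hpos := deltaAux_pos t
  have hsq : Real.sqrt (1 + 4 / deltaAux t) ^ 2 * deltaAux t = deltaAux t + 4 := by
    rw [Real.sq_sqrt (by positivity)]
    field_simp
  rw [deltaAux]
  linear_combination deltaAux t / 4 * hsq

theorem deltaAux_succ_sub (t : ℕ) :
    2 - 1 / deltaAux (t + 1) + deltaAux t = deltaAux (t + 1) := by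
  have hpos := deltaAux_pos (t + 1)
  field_simp
  linear_combination -sq_deltaAux_succ_sub_one t

theorem deltaSeq_eq_deltaAux_succ {L j : ℕ} (h : j < L) :
    deltaSeq L j = deltaAux (L - (j + 1) + 1) := by
  rw [deltaSeq]
  congr 1
  omega

theorem deltaSeq_pos (L j : ℕ) : 0 < deltaSeq L j := deltaAux_pos _

theorem one_lt_deltaSeq {L j : ℕ} (h : j < L) : 1 < deltaSeq L j := by
  rw [deltaSeq_eq_deltaAux_succ h]
  exact one_lt_deltaAux_succ _

theorem sq_deltaSeq_sub_one {L j : ℕ} (h : j < L) :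
    (deltaSeq L j - 1) ^ 2 = deltaSeq L j * deltaSeq L (j + 1) := by
  rw [deltaSeq_eq_deltaAux_succ h]
  exact sq_deltaAux_succ_sub_one _

theorem deltaSeq_self (L : ℕ) : deltaSeq L L = 1 := by simp [deltaSeq, deltaAux]

theorem aSeq_pos {L j : ℕ} (h : j ≤ L) : 0 < aSeq L j := by
  refine Finset.prod_pos fun i hi => one_div_pos.2 (sub_pos.2 ?_)
  have hi := one_lt_deltaSeq ((Finset.mem_Ico.1 hi).2.trans_le h)
  exact (div_lt_one (one_pos.trans hi)).2 hi

theorem aSeq_succ (L : ℕ) {j : ℕ} (hj : 1 ≤ j) :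
    aSeq L (j + 1) = aSeq L j * (1 / (1 - 1 / deltaSeq L j)) :=
  Finset.prod_Ico_succ_top hj _

theorem Ageq_eq_aSeq_mul_deltaSeq {L j : ℕ} (hj : 1 ≤ j) (hjL : j ≤ L) :
    Ageq L j = aSeq L j * deltaSeq L j := by
  induction hjL using Nat.decreasingInduction with
  | self => simp [Ageq, deltaSeq_self]
  | of_succ j hjL ih =>
    have hlt := one_lt_deltaSeq hjL
    have hne : deltaSeq L j - 1 ≠ 0 := (sub_pos.2 hlt).ne'
    have hpos := deltaSeq_pos L j
    have hA : Ageq L j = aSeq L j + Ageq L (j + 1) := by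
      rw [Ageq, Ageq, Finset.Icc_add_one_left_eq_Ioc, Finset.add_sum_Ioc_eq_sum_Icc hjL.le]
    have hratio : 1 / (1 - 1 / deltaSeq L j) = deltaSeq L j / (deltaSeq L j - 1) := by
      rw [one_sub_div hpos.ne', one_div_div]
    rw [hA, ih (by omega), aSeq_succ L hj, hratio]
    have := (aSeq_pos hjL.le).ne'
    field_simp
    linear_combination -sq_deltaSeq_sub_one hjL

theorem sum_two_sub_one_div_deltaSeq {L j : ℕ} (hjL : j ≤ L) :
    ∑ i ∈ Finset.Icc j L, (2 - 1 / deltaSeq L i) = deltaSeq L j := by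
  induction hjL using Nat.decreasingInduction with
  | self => norm_num [deltaSeq_self]
  | of_succ j hjL ih =>
    have hsplit := Finset.add_sum_Ioc_eq_sum_Icc (f := fun i => 2 - 1 / deltaSeq L i) hjL.le
    rw [← hsplit, ← Finset.Icc_add_one_left_eq_Ioc, ih,
      deltaSeq_eq_deltaAux_succ hjL]
    exact deltaAux_succ_sub _

/-- For every `j ∈ [L]`,
`Σ_{i=j}^{L} (2 − a_i/A_{≥i}) = A_{≥j}/a_j`. -/
theorem stmt_8 (L : ℕ) (hL : 0 < L) (j : ℕ) (hj1 : 1 ≤ j) (hjL : j ≤ L) :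
    ∑ i ∈ Finset.Icc j L, (2 - aSeq L i / Ageq L i) = Ageq L j / aSeq L j := by
  rw [Ageq_eq_aSeq_mul_deltaSeq hj1 hjL, mul_div_cancel_left₀ _ (aSeq_pos hjL).ne',
    ← sum_two_sub_one_div_deltaSeq hjL]
  refine Finset.sum_congr rfl fun i hi => ?_
  obtain ⟨hji, hiL⟩ := Finset.mem_Icc.1 hi
  rw [Ageq_eq_aSeq_mul_deltaSeq (hj1.trans hji) hiL, div_mul_cancel_left₀ (aSeq_pos hiL).ne',
    one_div]
end

section
/- For every j ∈ [L], one has 2j − H_j ≤ A_{≥ L−j+1} / a_{L−j+1} ≤ 2j − 1, where H_j = Σ_{i=1}^{j} 1/i is the j-th harmonic number. -/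
theorem one_le_deltaAux (t : ℕ) : 1 ≤ deltaAux t := by
  induction t with
  | zero => simp [deltaAux]
  | succ t ih =>
    rw [deltaAux]
    have : 0 ≤ ((1 + Real.sqrt (1 + 4 / deltaAux t)) / 2) * deltaAux t := by positivity
    linarith

theorem deltaAux_succ_sub_one_sq (t : ℕ) :
    (deltaAux (t + 1) - 1) ^ 2 = deltaAux t * deltaAux (t + 1) := by
  have h := one_le_deltaAux t
  have hs : Real.sqrt (1 + 4 / deltaAux t) ^ 2 = 1 + 4 / deltaAux t :=
    Real.sq_sqrt (by positivity)
  have hd : Real.sqrt (1 + 4 / deltaAux t) ^ 2 * deltaAux t = deltaAux t + 4 := by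
    rw [hs]; field_simp
  rw [deltaAux]
  linear_combination deltaAux t / 4 * hd

theorem deltaAux_succ_eq (t : ℕ) :
    deltaAux (t + 1) = deltaAux t + 2 - 1 / deltaAux (t + 1) := by
  have h := one_le_deltaAux (t + 1)
  field_simp
  linear_combination deltaAux_succ_sub_one_sq t

theorem deltaAux_le (t : ℕ) : deltaAux t ≤ 2 * t + 1 := by
  induction t with
  | zero => simp [deltaAux]
  | succ t ih =>
    have h := one_le_deltaAux (t + 1)
    have hp : 0 ≤ 1 / deltaAux (t + 1) := by positivity
    push_cast
    linarith [deltaAux_succ_eq t]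

theorem add_one_le_deltaAux (t : ℕ) : (t : ℝ) + 1 ≤ deltaAux t := by
  induction t with
  | zero => simp [deltaAux]
  | succ t ih =>
    have h := one_le_deltaAux (t + 1)
    have hp : 1 / deltaAux (t + 1) ≤ 1 := (div_le_one (by linarith)).2 h
    push_cast
    linarith [deltaAux_succ_eq t]

theorem two_mul_sub_harmonic_le_deltaAux (t : ℕ) :
    2 * ((t : ℝ) + 1) - ∑ i ∈ Finset.Icc 1 (t + 1), (1 : ℝ) / i ≤ deltaAux t := by
  induction t with
  | zero => norm_num [deltaAux]
  | succ t ih =>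
    have hp : 1 / deltaAux (t + 1) ≤ 1 / (((t + 1 : ℕ) : ℝ) + 1) :=
      one_div_le_one_div_of_le (by positivity) (add_one_le_deltaAux (t + 1))
    rw [Finset.sum_Icc_succ_top (by omega)]
    push_cast at *
    linarith [deltaAux_succ_eq t]

theorem aSeq_pos_s9 {L l : ℕ} (hl : l ≤ L) : 0 < aSeq L l := by
  refine Finset.prod_pos fun i hi => ?_
  rw [Finset.mem_Ico] at hi
  obtain ⟨s, hs⟩ : ∃ s, L - i = s + 1 := ⟨L - i - 1, by omega⟩
  have h := one_lt_deltaAux_succ s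
  rw [deltaSeq, hs]
  exact one_div_pos.2 (sub_pos.2 ((div_lt_one (by linarith)).2 h))

theorem Ageq_sub_eq {L t : ℕ} (ht : t < L) :
    Ageq L (L - t) = deltaAux t * aSeq L (L - t) := by
  induction t with
  | zero => simp [Ageq, deltaAux]
  | succ t ih =>
    obtain ⟨m, rfl⟩ : ∃ m, L = m + 1 + (t + 1) := ⟨L - (t + 1) - 1, by omega⟩
    specialize ih (by omega)
    have e1 : m + 1 + (t + 1) - (t + 1) = m + 1 := by omega
    have e2 : m + 1 + (t + 1) - t = m + 1 + 1 := by omega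
    have hd := one_lt_deltaAux_succ t
    have hd0 : deltaAux (t + 1) ≠ 0 := by linarith
    have hd1 : deltaAux (t + 1) - 1 ≠ 0 := by linarith
    have ha : aSeq (m + 1 + (t + 1)) (m + 1 + 1) =
        aSeq (m + 1 + (t + 1)) (m + 1) * (1 / (1 - 1 / deltaAux (t + 1))) := by
      rw [aSeq, Finset.prod_Ico_succ_top (by omega), deltaSeq,
        Nat.add_sub_cancel_left, aSeq]
    have hA : Ageq (m + 1 + (t + 1)) (m + 1) =
        aSeq (m + 1 + (t + 1)) (m + 1) + Ageq (m + 1 + (t + 1)) (m + 1 + 1) := by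
      rw [Ageq, ← Finset.add_sum_Ioc_eq_sum_Icc (by omega), Ageq, Finset.Icc_add_one_left_eq_Ioc]
    have hr : deltaAux t * (1 / (1 - 1 / deltaAux (t + 1))) = deltaAux (t + 1) - 1 := by
      have : 1 - 1 / deltaAux (t + 1) = (deltaAux (t + 1) - 1) / deltaAux (t + 1) := by
        field_simp
      rw [this, one_div_div, ← mul_div_assoc, div_eq_iff hd1]
      linear_combination -deltaAux_succ_sub_one_sq t
    rw [e2] at ih
    rw [e1, hA, ih, ha]
    linear_combination aSeq (m + 1 + (t + 1)) (m + 1) * hr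

/-- For every `j ∈ [L]`,
`2j − H_j ≤ A_{≥L−j+1}/a_{L−j+1} ≤ 2j − 1`, where `H_j = Σ_{i=1}^{j} 1/i`. -/
theorem stmt_9 (L : ℕ) (hL : 0 < L) (j : ℕ) (hj1 : 1 ≤ j) (hjL : j ≤ L) :
    2 * (j : ℝ) - ∑ i ∈ Finset.Icc 1 j, (1 : ℝ) / i ≤
      Ageq L (L - j + 1) / aSeq L (L - j + 1) ∧
    Ageq L (L - j + 1) / aSeq L (L - j + 1) ≤ 2 * (j : ℝ) - 1 := by
  obtain ⟨t, rfl⟩ : ∃ t, j = t + 1 := ⟨j - 1, by omega⟩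
  have hratio : Ageq L (L - t) / aSeq L (L - t) = deltaAux t := by
    rw [Ageq_sub_eq (by omega), mul_div_cancel_right₀ _ (aSeq_pos_s9 (by omega)).ne']
  rw [show L - (t + 1) + 1 = L - t by omega, hratio]
  push_cast
  exact ⟨two_mul_sub_harmonic_le_deltaAux t, by linarith [deltaAux_le t]⟩
end
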